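/- Suppose a ≥ 1/2 and L satisfies Assumptions A1 and A2. Then there exists a constant C > 0 such that for every n ≥ 2 and every θ0 ∈ ℝ, E_{X ~ N(θ0,1)} [ sup_{τ ∈ [1/n, 1]} Var(θ | X, τ) ] ≤ C log n. -/

import Mathlib

open MeasureTheory ProbabilityTheory Real Filter Set

noncomputable section

namespace PaperGL

/-- Posterior density kernel of the shrinkage coefficient `κ` given `(x, τ)`:
`π(κ | x, τ) ∝ κ^(a-1/2) (1-κ)^(-a-1) L(τ⁻²(κ⁻¹-1)) exp((1-κ)x²/2)` on `(0,1)`. -/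
def kdens (a : ℝ) (L : ℝ → ℝ) (x τ κ : ℝ) : ℝ :=
  κ ^ (a - 1/2) * (1 - κ) ^ (-a - 1) * L ((1/τ^2) * (1/κ - 1)) * Real.exp ((1 - κ) * x^2 / 2)

/-- Posterior expectation of `g(κ)` given `(x, τ)`. -/
def kExp (a : ℝ) (L : ℝ → ℝ) (x τ : ℝ) (g : ℝ → ℝ) : ℝ :=
  (∫ κ in Set.Ioo (0:ℝ) 1, g κ * kdens a L x τ κ) /
    (∫ κ in Set.Ioo (0:ℝ) 1, kdens a L x τ κ)

/-- `E(1−κ | x, τ)`. -/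
def E1mK (a : ℝ) (L : ℝ → ℝ) (x τ : ℝ) : ℝ := kExp a L x τ (fun κ => 1 - κ)

/-- Posterior mean `T_τ(x) = x · E(1−κ | x, τ)`. -/
def postMean (a : ℝ) (L : ℝ → ℝ) (τ x : ℝ) : ℝ := x * E1mK a L x τ

/-- Posterior variance `Var(θ | x, τ)` of the mixture over `κ` of `N((1−κ)x, 1−κ)`. -/
def postVar (a : ℝ) (L : ℝ → ℝ) (x τ : ℝ) : ℝ :=
  E1mK a L x τ + x^2 * (kExp a L x τ (fun κ => (1 - κ)^2) - (E1mK a L x τ)^2)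

/-- `E(1−κ | x, τ)` in the `t = τ⁻²(κ⁻¹−1)` parametrisation. -/
def E1mKt (a : ℝ) (L : ℝ → ℝ) (x τ : ℝ) : ℝ :=
  (τ^2 * ∫ t in Set.Ioi (0:ℝ),
      (1 + t*τ^2) ^ (-(3:ℝ)/2) * t ^ (-a) * L t * Real.exp ((x^2/2) * (t*τ^2/(1+t*τ^2)))) /
  (∫ t in Set.Ioi (0:ℝ),
      (1 + t*τ^2) ^ (-(1:ℝ)/2) * t ^ (-a-1) * L t * Real.exp ((x^2/2) * (t*τ^2/(1+t*τ^2))))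

/-- The empirical Bayes estimate `τ̂` of the global shrinkage parameter. -/
def tauHat (c1 c2 : ℝ) (n : ℕ) (x : Fin n → ℝ) : ℝ :=
  max (1/(n:ℝ)) ((1/(c2*n)) * ∑ i, if Real.sqrt (c1 * Real.log n) < |x i| then (1:ℝ) else 0)

/-- Nearly black vectors: `θ ∈ ℓ₀[q]`. -/
def sparse (n q : ℕ) (θ : Fin n → ℝ) : Prop := Nat.card {i : Fin n // θ i ≠ 0} ≤ q

/-- The sampling distribution `N_n(θ₀, I_n)`. -/
def Pmeas (n : ℕ) (θ0 : Fin n → ℝ) : Measure (Fin n → ℝ) :=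
  Measure.pi fun i => gaussianReal (θ0 i) 1

/-- `q_n ∝ n^β` (two-sided proportionality). -/
def propTo (q : ℕ → ℕ) (β : ℝ) : Prop :=
  ∃ k1 k2 : ℝ, 0 < k1 ∧ 0 < k2 ∧
    ∀ᶠ n : ℕ in atTop, k1 * (n:ℝ)^β ≤ (q n : ℝ) ∧ (q n : ℝ) ≤ k2 * (n:ℝ)^β

/-- `p_n ∝ n^(-e)` for a real sequence. -/
def propToR (p : ℕ → ℝ) (β : ℝ) : Prop :=
  ∃ k1 k2 : ℝ, 0 < k1 ∧ 0 < k2 ∧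
    ∀ᶠ n : ℕ in atTop, k1 * (n:ℝ)^β ≤ p n ∧ p n ≤ k2 * (n:ℝ)^β

/-- Assumptions (A1) and (A2) on the slowly varying function `L`, together with
positivity, measurability. -/
def AssumpL (L : ℝ → ℝ) (Mb c0 t0 : ℝ) : Prop :=
  Measurable L ∧ (∀ t, 0 < t → 0 < L t) ∧ (∀ t, 0 < t → L t ≤ Mb) ∧
    0 < c0 ∧ 0 < t0 ∧ ∀ t, t0 ≤ t → c0 ≤ L t

/-- Integrability of `t^(−a−1) L t` on `(0,∞)` with positive integral, and `K` its inverse. -/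
def Kcond (a : ℝ) (L : ℝ → ℝ) (K : ℝ) : Prop :=
  MeasureTheory.IntegrableOn (fun t => t ^ (-a-1) * L t) (Set.Ioi (0:ℝ)) ∧
    0 < ∫ t in Set.Ioi (0:ℝ), t ^ (-a-1) * L t ∧
    K = (∫ t in Set.Ioi (0:ℝ), t ^ (-a-1) * L t)⁻¹

/-- The κ-posterior as a probability measure on `(0,1)`. -/
def kPostMeasure (a : ℝ) (L : ℝ → ℝ) (x τ : ℝ) : Measure ℝ :=
  (∫⁻ κ in Set.Ioo (0:ℝ) 1, ENNReal.ofReal (kdens a L x τ κ))⁻¹ •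
    ((volume.restrict (Set.Ioo (0:ℝ) 1)).withDensity fun κ => ENNReal.ofReal (kdens a L x τ κ))

/-- The posterior distribution of `θ` given `(x, τ)`: mixture over `κ` of `N((1−κ)x, 1−κ)`. -/
def thetaPost (a : ℝ) (L : ℝ → ℝ) (x τ : ℝ) : Measure ℝ :=
  (kPostMeasure a L x τ).bind fun κ => gaussianReal ((1-κ)*x) (Real.toNNReal (1-κ))

/-- `Π_τ(· | X)`: the posterior of the vector `θ` given `(X, τ)`. -/
def PiTau (a : ℝ) (L : ℝ → ℝ) (n : ℕ) (X : Fin n → ℝ) (τ : ℝ) : Measure (Fin n → ℝ) :=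
  Measure.pi fun i => thetaPost a L (X i) τ

/-- Marginal density `m(x, τ)` of one observation given `τ` (mixing over `l = λ²`). -/
def marg (a K : ℝ) (L : ℝ → ℝ) (x τ : ℝ) : ℝ :=
  ∫ l in Set.Ioi (0:ℝ), K * l ^ (-a-1) * L l *
    ((Real.sqrt (2 * Real.pi * (1 + l * τ^2)))⁻¹ * Real.exp (-(x^2) / (2 * (1 + l * τ^2))))

/-- Posterior density of `τ` given `X`, for a prior `π2` supported on `[lo, hi]`. -/
def tauWeight (a K : ℝ) (L : ℝ → ℝ) (π2 : ℝ → ℝ) (lo hi : ℝ) (n : ℕ)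
    (X : Fin n → ℝ) (τ : ℝ) : ℝ :=
  (π2 τ * ∏ i, marg a K L (X i) τ) /
    ∫ s in Set.Icc lo hi, π2 s * ∏ i, marg a K L (X i) s

/-- Full Bayes posterior mean `θ̂_i = ∫ T_τ(X_i) π_{2n}(τ|X) dτ`. -/
def fbMean (a K : ℝ) (L : ℝ → ℝ) (π2 : ℝ → ℝ) (n : ℕ) (X : Fin n → ℝ) (i : Fin n) : ℝ :=
  ∫ τ in Set.Icc ((n:ℝ)⁻¹) 1, postMean a L τ (X i) * tauWeight a K L π2 ((n:ℝ)⁻¹) 1 n X τ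

/-- Full Bayes posterior variance `Var(θ_i | X)`. -/
def fbVar (a K : ℝ) (L : ℝ → ℝ) (π2 : ℝ → ℝ) (n : ℕ) (X : Fin n → ℝ) (i : Fin n) : ℝ :=
  (∫ τ in Set.Icc ((n:ℝ)⁻¹) 1,
      (postVar a L (X i) τ + (postMean a L τ (X i))^2) * tauWeight a K L π2 ((n:ℝ)⁻¹) 1 n X τ)
    - (fbMean a K L π2 n X i)^2

/-- The posterior distribution of `τ` given `X`, as a measure on `[lo, hi]`. -/
def tauPostMeasure (a K : ℝ) (L : ℝ → ℝ) (π2 : ℝ → ℝ) (lo hi : ℝ) (n : ℕ)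
    (X : Fin n → ℝ) : Measure ℝ :=
  (∫⁻ τ in Set.Icc lo hi, ENNReal.ofReal (π2 τ * ∏ i, marg a K L (X i) τ))⁻¹ •
    ((volume.restrict (Set.Icc lo hi)).withDensity
      fun τ => ENNReal.ofReal (π2 τ * ∏ i, marg a K L (X i) τ))

/-- The full Bayes posterior `Π(· | X)` of `θ` given `X`. -/
def PiFull (a K : ℝ) (L : ℝ → ℝ) (π2 : ℝ → ℝ) (n : ℕ) (X : Fin n → ℝ) :
    Measure (Fin n → ℝ) :=
  (tauPostMeasure a K L π2 ((n:ℝ)⁻¹) 1 n X).bind fun τ => PiTau a L n X τ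

/-- Condition (C1): `π_{2n}` is a density supported on `[1/n, 1]`. -/
def CondC1 (π2 : ℕ → ℝ → ℝ) : Prop :=
  (∀ (n : ℕ) (τ : ℝ), 0 ≤ π2 n τ) ∧ (∀ (n : ℕ) (τ : ℝ), τ ∉ Set.Icc ((n:ℝ)⁻¹) 1 → π2 n τ = 0) ∧
    ∀ n : ℕ, 1 ≤ n → ∫ τ in Set.Icc ((n:ℝ)⁻¹) 1, π2 n τ = 1

/-- `t_n = C_u π^{3/2} (q_n/n) √(log(n/q_n))`. -/
def tseq (Cu : ℝ) (q : ℕ → ℕ) (n : ℕ) : ℝ :=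
  Cu * Real.pi ^ ((3:ℝ)/2) * ((q n : ℝ)/n) * Real.sqrt (Real.log ((n:ℝ)/(q n)))

/-- Condition (C2). -/
def CondC2 (π2 : ℕ → ℝ → ℝ) (q : ℕ → ℕ) : Prop :=
  ∃ Cu c M1 K' : ℝ, 0 < Cu ∧ c ≤ Cu/2 ∧ 1 ≤ M1 ∧ 0 < K' ∧
    ∀ᶠ n : ℕ in atTop,
      K' * Real.exp (-c * q n) ≤
        ((q n : ℝ)/n)^M1 * ∫ τ in Set.Icc (tseq Cu q n / 2) (tseq Cu q n), π2 n τ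

/-- Full Bayes posterior shrinkage weight `E(1−κ_i | X)`. -/
def fbShrink (a K : ℝ) (L : ℝ → ℝ) (π2 : ℝ → ℝ) (lo hi : ℝ) (n : ℕ)
    (X : Fin n → ℝ) (i : Fin n) : ℝ :=
  ∫ τ in Set.Icc lo hi, E1mK a L (X i) τ * tauWeight a K L π2 lo hi n X τ

/-- Marginal two-groups distribution of one observation:
`(1−p) N(0,1) + p N(0, 1+ψ²)` with `u = ψ²`. -/
def mixM (p u : ℝ) : Measure ℝ :=
  ENNReal.ofReal (1 - p) • gaussianReal 0 1 +
    ENNReal.ofReal p • gaussianReal 0 (Real.toNNReal (1 + u))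

/-- Joint law of `X` given `ν_i = 0`. -/
def nullMeas (n : ℕ) (i : Fin n) (p u : ℝ) : Measure (Fin n → ℝ) :=
  Measure.pi fun j => if j = i then gaussianReal 0 1 else mixM p u

/-- Joint law of `X` given `ν_i = 1`. -/
def altMeas (n : ℕ) (i : Fin n) (p u : ℝ) : Measure (Fin n → ℝ) :=
  Measure.pi fun j => if j = i then gaussianReal 0 (Real.toNNReal (1 + u)) else mixM p u

/-- Type I error `t^{FB}_{1i}` of the full Bayes rule. -/
def t1FB (a K : ℝ) (L : ℝ → ℝ) (π2 : ℕ → ℝ → ℝ) (α : ℕ → ℝ) (p u : ℕ → ℝ)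
    (n : ℕ) (i : Fin n) : ℝ :=
  ((nullMeas n i (p n) (u n))
    {x | 1/2 < fbShrink a K L (π2 n) ((n:ℝ)⁻¹) (α n) n x i}).toReal

/-- Type II error `t^{FB}_{2i}` of the full Bayes rule. -/
def t2FB (a K : ℝ) (L : ℝ → ℝ) (π2 : ℕ → ℝ → ℝ) (α : ℕ → ℝ) (p u : ℕ → ℝ)
    (n : ℕ) (i : Fin n) : ℝ :=
  ((altMeas n i (p n) (u n))
    {x | fbShrink a K L (π2 n) ((n:ℝ)⁻¹) (α n) n x i ≤ 1/2}).toReal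

/-- Bayes risk `R^{FB}_{OG}` of the full Bayes rule. -/
def RFB (a K : ℝ) (L : ℝ → ℝ) (π2 : ℕ → ℝ → ℝ) (α : ℕ → ℝ) (p u : ℕ → ℝ) (n : ℕ) : ℝ :=
  ∑ i : Fin n, ((1 - p n) * t1FB a K L π2 α p u n i + p n * t2FB a K L π2 α p u n i)

/-- Condition (C3): `π_{2n}` is a density supported on `[1/n, α_n]`,
with `α_n → 0` and `n α_n → ∞`. -/
def CondC3 (π2 : ℕ → ℝ → ℝ) (α : ℕ → ℝ) : Prop :=
  (∀ (n : ℕ) (τ : ℝ), 0 ≤ π2 n τ) ∧ (∀ (n : ℕ) (τ : ℝ), τ ∉ Set.Icc ((n:ℝ)⁻¹) (α n) → π2 n τ = 0) ∧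
    (∀ n : ℕ, 1 ≤ n → ∫ τ in Set.Icc ((n:ℝ)⁻¹) (α n), π2 n τ = 1) ∧
    Tendsto α atTop (nhds 0) ∧ Tendsto (fun n : ℕ => (n:ℝ) * α n) atTop atTop

/-- Assumption 2 of Bogdan et al.: `p_n → 0`, `u_n = ψ_n² → ∞`,
`log v_n / u_n → C ∈ (0,∞)` with `v_n = u_n f_n²`, `f_n = (1-p_n)/p_n`. -/
def Assump2 (p u : ℕ → ℝ) (C : ℝ) : Prop :=
  Tendsto p atTop (nhds 0) ∧ Tendsto u atTop atTop ∧ 0 < C ∧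
    Tendsto (fun n => Real.log (u n * ((1 - p n)/p n)^2) / u n) atTop (nhds C)

/-- Standard normal cdf. -/
def Phi (z : ℝ) : ℝ := ((gaussianReal 0 1) (Set.Iic z)).toReal

/-- Squared threshold of the Bayes Oracle. -/
def csq (p u : ℕ → ℝ) (n : ℕ) : ℝ :=
  ((1 + u n)/u n) * (Real.log (1 + u n) + 2 * Real.log ((1 - p n)/p n))

/-- Type I error of the Bayes Oracle. -/
def t1BO (p u : ℕ → ℝ) (n : ℕ) : ℝ :=
  ((gaussianReal 0 1) {x : ℝ | csq p u n < x^2}).toReal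

/-- Type II error of the Bayes Oracle. -/
def t2BO (p u : ℕ → ℝ) (n : ℕ) : ℝ :=
  ((gaussianReal 0 (Real.toNNReal (1 + u n))) {x : ℝ | x^2 ≤ csq p u n}).toReal

/-- Bayes risk of the Bayes Oracle. -/
def RBO (p u : ℕ → ℝ) (n : ℕ) : ℝ :=
  (n:ℝ) * ((1 - p n) * t1BO p u n + p n * t2BO p u n)

end PaperGL

namespace PaperGL

lemma kdens_nonneg {a : ℝ} {L : ℝ → ℝ} (hL : ∀ t, 0 < t → 0 < L t) (x : ℝ) {τ κ : ℝ}
    (hτ : 0 < τ) (hκ : κ ∈ Ioo (0:ℝ) 1) : 0 ≤ kdens a L x τ κ := by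
  obtain ⟨h0, h1⟩ := hκ
  have h2 : 0 < 1 - κ := by linarith
  have h3 : 0 < (1/τ^2) * (1/κ - 1) := by
    have : 0 < 1/κ - 1 := by rw [sub_pos, lt_div_iff₀ h0]; linarith
    positivity
  have h4 := hL _ h3
  unfold kdens
  positivity

/-- The prior part of the density of `κ`, rewritten through `t = τ⁻²(κ⁻¹-1)`. -/
lemma prior_eq {a : ℝ} {L : ℝ → ℝ} {τ κ : ℝ} (hτ : 0 < τ) (hκ : κ ∈ Ioo (0:ℝ) 1) :
    κ ^ (a - 1/2) * (1 - κ) ^ (-a - 1) * L ((1/τ^2) * (1/κ - 1)) =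
      τ ^ (-2 * a) * κ ^ ((1:ℝ)/2) * ((1/τ^2) * (1/κ^2) *
        (((1/τ^2) * (1/κ - 1)) ^ (-a - 1) * L ((1/τ^2) * (1/κ - 1)))) := by
  obtain ⟨h0, h1⟩ := hκ
  have h2 : 0 < 1 - κ := by linarith
  have e : (1/τ^2) * (1/κ - 1) = (1 - κ) * (κ⁻¹ * (τ^2)⁻¹) := by field_simp
  have e2 : ((1/τ^2) * (1/κ - 1)) ^ (-a - 1) =
      (1 - κ) ^ (-a - 1) * (κ ^ (a + 1) * τ ^ (2 * a + 2)) := by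
    rw [e, mul_rpow h2.le (by positivity), mul_rpow (by positivity) (by positivity),
      inv_rpow h0.le, inv_rpow (by positivity), ← rpow_neg h0.le, ← rpow_neg (by positivity),
      ← rpow_natCast τ 2, ← rpow_mul hτ.le]
    congr 3 <;> push_cast <;> ring_nf
  have e3 : κ ^ (a - 1/2) = κ ^ ((1:ℝ)/2) * ((1/κ^2) * κ ^ (a + 1)) := by
    rw [one_div (κ^2), ← rpow_natCast κ 2, ← rpow_neg h0.le, ← rpow_add h0, ← rpow_add h0]
    congr 1; push_cast; ring
  have e4 : τ ^ (-2 * a) * ((1/τ^2) * τ ^ (2 * a + 2)) = 1 := by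
    rw [one_div (τ^2), ← rpow_natCast τ 2, ← rpow_neg hτ.le, ← rpow_add hτ, ← rpow_add hτ]
    convert rpow_zero τ using 2; push_cast; ring
  rw [e2, e3]
  linear_combination (-(κ ^ ((1:ℝ)/2) * (1/κ^2) * κ ^ (a+1) * (1 - κ) ^ (-a - 1) *
    L ((1/τ^2) * (1/κ - 1)))) * e4

/-- Change of variables `t = τ⁻²(κ⁻¹-1)`. -/
lemma integral_comp_le {g : ℝ → ℝ} (hg : IntegrableOn g (Ioi 0)) (hg0 : ∀ t, 0 < t → 0 ≤ g t)
    {τ : ℝ} (hτ : 0 < τ) :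
    IntegrableOn (fun κ => (1/τ^2) * (1/κ^2) * g ((1/τ^2) * (1/κ - 1))) (Ioo 0 1) ∧
      ∫ κ in Ioo (0:ℝ) 1, (1/τ^2) * (1/κ^2) * g ((1/τ^2) * (1/κ - 1)) ≤
        ∫ t in Ioi (0:ℝ), g t := by
  set f : ℝ → ℝ := fun κ => (1/τ^2) * (1/κ - 1) with hf
  set f' : ℝ → ℝ := fun κ => -((1/τ^2) * (1/κ^2)) with hf'
  have hd : ∀ κ ∈ Ioo (0:ℝ) 1, HasDerivWithinAt f (f' κ) (Ioo 0 1) κ := by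
    intro κ hκ
    have h := ((hasDerivAt_inv hκ.1.ne').sub_const 1).const_mul (1/τ^2)
    have e1 : f = fun y => 1/τ^2 * (y⁻¹ - 1) := by funext y; simp only [hf, one_div]
    have e2 : f' κ = 1/τ^2 * -(κ^2)⁻¹ := by simp only [hf', one_div, mul_neg]
    rw [e1, e2]
    exact h.hasDerivWithinAt
  have hinj : InjOn f (Ioo 0 1) := by
    intro u hu v hv huv
    have h1 : (1/τ^2) ≠ 0 := by positivity
    have h2 := mul_left_cancel₀ h1 huv
    have h3 : u⁻¹ = v⁻¹ := by simpa using h2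
    exact inv_injective h3
  have himg : f '' Ioo 0 1 ⊆ Ioi 0 := by
    rintro _ ⟨κ, hκ, rfl⟩
    have : 0 < 1/κ - 1 := by rw [sub_pos, lt_div_iff₀ hκ.1]; linarith [hκ.2]
    have h2 : 0 < (1/τ^2) * (1/κ - 1) := by positivity
    exact h2
  have hcongr : (fun κ => |f' κ| • g (f κ)) =
      fun κ => (1/τ^2) * (1/κ^2) * g ((1/τ^2) * (1/κ - 1)) := by
    funext κ
    simp only [hf', hf, abs_neg, smul_eq_mul]
    rw [abs_of_nonneg (by positivity)]
  have hi := integrableOn_image_iff_integrableOn_abs_deriv_smul measurableSet_Ioo hd hinj g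
  have he := integral_image_eq_integral_abs_deriv_smul measurableSet_Ioo hd hinj g
  rw [hcongr] at hi he
  refine ⟨hi.1 (hg.mono_set himg), he ▸ ?_⟩
  refine setIntegral_mono_set hg ?_ himg.eventuallyLE
  filter_upwards [ae_restrict_mem measurableSet_Ioi] with t ht using hg0 t ht

lemma kdens_integrableOn {a : ℝ} {L : ℝ → ℝ} {Mb c0 t0 K : ℝ} (hL : AssumpL L Mb c0 t0)
    (hK : Kcond a L K) (x : ℝ) {τ : ℝ} (hτ : 0 < τ) :
    IntegrableOn (kdens a L x τ) (Ioo 0 1) := by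
  have hg0 : ∀ t, 0 < t → 0 ≤ t ^ (-a-1) * L t := fun t ht => by
    have := hL.2.1 t ht; positivity
  have hm : Measurable (kdens a L x τ) := by
    have := hL.1
    unfold kdens
    fun_prop
  refine Integrable.mono' (((integral_comp_le hK.1 hg0 hτ).1.const_mul
    (τ ^ (-2 * a) * rexp (x^2/2)))) hm.aestronglyMeasurable ?_
  filter_upwards [ae_restrict_mem measurableSet_Ioo] with κ hκ
  rw [Real.norm_of_nonneg (kdens_nonneg hL.2.1 x hτ hκ)]
  unfold kdens
  rw [prior_eq hτ hκ]
  have hs : κ ^ ((1:ℝ)/2) ≤ 1 := rpow_le_one hκ.1.le hκ.2.le (by norm_num)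
  have hE : rexp ((1 - κ) * x^2 / 2) ≤ rexp (x^2/2) := by
    apply exp_le_exp.2
    nlinarith [sq_nonneg x, hκ.1]
  have hpos : 0 < (1/τ^2) * (1/κ - 1) := by
    have : 0 < 1/κ - 1 := by rw [sub_pos, lt_div_iff₀ hκ.1]; linarith [hκ.2]
    positivity
  have hG : 0 ≤ (1/τ^2) * (1/κ^2) *
        (((1/τ^2) * (1/κ - 1)) ^ (-a - 1) * L ((1/τ^2) * (1/κ - 1))) :=
    mul_nonneg (by positivity) (hg0 _ hpos)
  set G := (1/τ^2) * (1/κ^2) *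
        (((1/τ^2) * (1/κ - 1)) ^ (-a - 1) * L ((1/τ^2) * (1/κ - 1)))
  have hT : 0 ≤ τ ^ (-2 * a) := by positivity
  have hk : 0 ≤ κ ^ ((1:ℝ)/2) := rpow_nonneg hκ.1.le _
  calc τ ^ (-2 * a) * κ ^ ((1:ℝ)/2) * G * rexp ((1 - κ) * x^2 / 2)
      ≤ τ ^ (-2 * a) * 1 * G * rexp (x^2/2) := by gcongr
    _ = _ := by ring

lemma integral_mul_kdens_le {a : ℝ} {L : ℝ → ℝ} {Mb c0 t0 K : ℝ} (ha : 1/2 ≤ a)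
    (hL : AssumpL L Mb c0 t0) (hK : Kcond a L K) {x τ : ℝ} (hτ : 0 < τ) (hx : 0 < x^2) :
    ∫ κ in Ioo (0:ℝ) 1, κ * kdens a L x τ κ ≤
      rexp (x^2/2) * ((2 ^ (a+1) * Mb) * ((1/(x^2/2)) ^ (a + 3/2) * Real.Gamma (a + 3/2)) +
        τ ^ (-2 * a) * rexp (-(x^2/4)) * ∫ t in Ioi (0:ℝ), t ^ (-a-1) * L t) := by
  have hg0 : ∀ t, 0 < t → 0 ≤ t ^ (-a-1) * L t := fun t ht => by
    have := hL.2.1 t ht; positivity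
  have hMb : 0 ≤ Mb := ((hL.2.1 1 one_pos).le).trans (hL.2.2.1 1 one_pos)
  obtain ⟨hJi, hJ⟩ := integral_comp_le hK.1 hg0 hτ
  have hΓ := integral_rpow_mul_exp_neg_mul_Ioi (a := a + 3/2) (r := x^2/2) (by linarith)
    (by positivity)
  have hΓi : IntegrableOn (fun t : ℝ => t ^ (a + 3/2 - 1) * rexp (-(x^2/2 * t))) (Ioi 0) :=
    .of_integral_ne_zero (by
      rw [hΓ]
      have := Real.Gamma_pos_of_pos (s := a + 3/2) (by linarith)
      positivity)
  have hΓi' := hΓi.mono_set ((Ioo_subset_Ioi_self : Ioo (0:ℝ) 1 ⊆ Ioi 0))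
  have hΓle : ∫ t in Ioo (0:ℝ) 1, t ^ (a + 3/2 - 1) * rexp (-(x^2/2 * t)) ≤
      (1/(x^2/2)) ^ (a + 3/2) * Real.Gamma (a + 3/2) := by
    rw [← hΓ]
    refine setIntegral_mono_set hΓi ?_ Ioo_subset_Ioi_self.eventuallyLE
    filter_upwards [ae_restrict_mem measurableSet_Ioi] with t ht
    have ht' : 0 < t := ht
    simp only [Pi.zero_apply]
    positivity
  have hdom : ∀ κ ∈ Ioo (0:ℝ) 1, κ * kdens a L x τ κ ≤
      rexp (x^2/2) * (2 ^ (a+1) * Mb) * (κ ^ (a + 3/2 - 1) * rexp (-(x^2/2 * κ))) +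
      rexp (x^2/2) * (τ ^ (-2 * a) * rexp (-(x^2/4))) * ((1/τ^2) * (1/κ^2) *
        (((1/τ^2) * (1/κ - 1)) ^ (-a - 1) * L ((1/τ^2) * (1/κ - 1)))) := by
    intro κ hκ
    obtain ⟨h0, h1⟩ := id hκ
    have h2 : 0 < 1 - κ := by linarith
    have hpos : 0 < (1/τ^2) * (1/κ - 1) := by
      have : 0 < 1/κ - 1 := by rw [sub_pos, lt_div_iff₀ h0]; linarith
      positivity
    have hG : 0 ≤ (1/τ^2) * (1/κ^2) *
        (((1/τ^2) * (1/κ - 1)) ^ (-a - 1) * L ((1/τ^2) * (1/κ - 1))) :=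
      mul_nonneg (by positivity) (hg0 _ hpos)
    have hE : rexp ((1 - κ) * x^2 / 2) = rexp (x^2/2) * rexp (-(x^2/2 * κ)) := by
      rw [← Real.exp_add]; congr 1; ring
    rcases le_total κ (1/2) with hk | hk
    · refine le_add_of_le_of_nonneg ?_ (by positivity)
      unfold kdens
      have e1 : κ ^ (a + 3/2 - 1) = κ * κ ^ (a - 1/2) := by
        nth_rewrite 2 [← rpow_one κ]
        rw [← rpow_add h0]; congr 1; ring
      have e2 : (1 - κ) ^ (-a - 1) ≤ 2 ^ (a + 1) := by
        have h5 : (1 - κ) ^ (-a - 1) ≤ ((1:ℝ)/2) ^ (-a - 1) :=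
          rpow_le_rpow_of_nonpos (by norm_num) (by linarith) (by linarith)
        refine h5.trans (le_of_eq ?_)
        rw [one_div, inv_rpow (by norm_num), ← rpow_neg (by norm_num)]
        congr 1; ring
      have e3 := hL.2.2.1 _ hpos
      have e4 := (hL.2.1 _ hpos).le
      rw [hE, e1]
      calc κ * (κ ^ (a - 1/2) * (1 - κ) ^ (-a - 1) * L ((1/τ^2) * (1/κ - 1)) *
            (rexp (x^2/2) * rexp (-(x^2/2 * κ))))
          ≤ κ * (κ ^ (a - 1/2) * 2 ^ (a + 1) * Mb *
            (rexp (x^2/2) * rexp (-(x^2/2 * κ)))) := by gcongr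
        _ = _ := by ring
    · refine le_add_of_nonneg_of_le (by positivity) ?_
      unfold kdens
      rw [prior_eq hτ hκ, hE]
      have hs : κ ^ ((1:ℝ)/2) ≤ 1 := rpow_le_one h0.le h1.le (by norm_num)
      have hE2 : rexp (-(x^2/2 * κ)) ≤ rexp (-(x^2/4)) := by
        apply exp_le_exp.2; nlinarith
      set G := (1/τ^2) * (1/κ^2) *
        (((1/τ^2) * (1/κ - 1)) ^ (-a - 1) * L ((1/τ^2) * (1/κ - 1)))
      calc κ * (τ ^ (-2 * a) * κ ^ ((1:ℝ)/2) * G * (rexp (x^2/2) * rexp (-(x^2/2 * κ))))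
          ≤ 1 * (τ ^ (-2 * a) * 1 * G * (rexp (x^2/2) * rexp (-(x^2/4)))) := by gcongr
        _ = _ := by ring
  have hi1 := hΓi'.const_mul (rexp (x^2/2) * (2 ^ (a+1) * Mb))
  have hi2 := hJi.const_mul (rexp (x^2/2) * (τ ^ (-2 * a) * rexp (-(x^2/4))))
  have h := integral_mono_of_nonneg (μ := volume.restrict (Ioo (0:ℝ) 1))
    (f := fun κ => κ * kdens a L x τ κ) (by
      filter_upwards [ae_restrict_mem measurableSet_Ioo] with κ hκ
      exact mul_nonneg hκ.1.le (kdens_nonneg hL.2.1 x hτ hκ)) (hi1.add hi2) (by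
      filter_upwards [ae_restrict_mem measurableSet_Ioo] with κ hκ using hdom κ hκ)
  refine h.trans ?_
  simp only [Pi.add_apply]
  rw [integral_add hi1 hi2, integral_const_mul, integral_const_mul, mul_add]
  refine add_le_add ?_ ?_
  · rw [mul_assoc]
    gcongr
  · rw [mul_assoc]
    gcongr

lemma integral_kdens_ge {a : ℝ} {L : ℝ → ℝ} {Mb c0 t0 K : ℝ} (ha : 1/2 ≤ a)
    (hL : AssumpL L Mb c0 t0) (hK : Kcond a L K) {x τ : ℝ} (hτ : 0 < τ) (hτ1 : τ ≤ 1)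
    (hx : 1 ≤ x^2) :
    rexp (x^2/2) * (c0 * rexp (-(1/2)) * (1/(2*(1+t0))) ^ (a + 1/2) * (x^2) ^ (-(a + 1/2))) ≤
      ∫ κ in Ioo (0:ℝ) 1, kdens a L x τ κ := by
  have hi := kdens_integrableOn hL hK x hτ
  obtain ⟨-, hLpos, -, hc0, ht0, hLc⟩ := hL
  set s : ℝ := 1/(2*(1+t0)) * (x^2)⁻¹ with hs
  have hy : (x^2)⁻¹ ≤ 1 := inv_le_one_of_one_le₀ hx
  have hy0 : 0 < x^2 := by linarith
  have hs0 : 0 < s := by positivity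
  have h2s : 2 * s = 1/(1+t0) * (x^2)⁻¹ := by rw [hs]; field_simp
  have hδ : 1/(1+t0) < 1 := by rw [div_lt_one (by positivity)]; linarith
  have hδ0 : 0 < 1/(1+t0) := by positivity
  have h2sδ : 2 * s ≤ 1/(1+t0) := by rw [h2s]; exact mul_le_of_le_one_right hδ0.le hy
  have hsub : Ioo s (2*s) ⊆ Ioo 0 1 := fun κ hκ => ⟨hs0.trans hκ.1, by linarith [hκ.2]⟩
  have hlow : ∀ κ ∈ Ioo s (2*s),
      s ^ (a - 1/2) * c0 * (rexp (x^2/2) * rexp (-(1/2))) ≤ kdens a L x τ κ := by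
    intro κ hκ
    obtain ⟨h0, h1⟩ := hsub hκ
    have h2 : 0 < 1 - κ := by linarith
    have hκδ : κ * (1 + t0) ≤ 1 := by
      have : κ ≤ 1/(1+t0) := hκ.2.le.trans h2sδ
      rwa [le_div_iff₀ (by positivity)] at this
    have hφ : t0 ≤ (1/τ^2) * (1/κ - 1) := by
      have h3 : t0 ≤ 1/κ - 1 := by
        rw [le_sub_iff_add_le, le_div_iff₀ h0]; linarith
      have h4 : 1 ≤ 1/τ^2 := by
        rw [le_div_iff₀ (by positivity)]; nlinarith
      nlinarith
    have e1 : s ^ (a - 1/2) ≤ κ ^ (a - 1/2) := rpow_le_rpow hs0.le hκ.1.le (by linarith)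
    have e2 : 1 ≤ (1 - κ) ^ (-a - 1) :=
      one_le_rpow_of_pos_of_le_one_of_nonpos h2 (by linarith) (by linarith)
    have e3 := hLc _ hφ
    have e4 : rexp (x^2/2) * rexp (-(1/2)) ≤ rexp ((1 - κ) * x^2 / 2) := by
      rw [← Real.exp_add]
      apply exp_le_exp.2
      have : κ * x^2 ≤ 1 := by
        calc κ * x^2 ≤ (2 * s) * x^2 := by have := hκ.2; gcongr
          _ = 1/(1+t0) := by rw [h2s, inv_mul_cancel_right₀ hy0.ne']
          _ ≤ 1 := hδ.le
      linarith
    have e5 := (hc0.trans_le e3).le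
    unfold kdens
    calc s ^ (a - 1/2) * c0 * (rexp (x^2/2) * rexp (-(1/2)))
        = s ^ (a - 1/2) * 1 * c0 * (rexp (x^2/2) * rexp (-(1/2))) := by ring
      _ ≤ _ := by gcongr
  have h1 := setIntegral_ge_of_const_le_real measurableSet_Ioo (by simp) hlow (hi.mono_set hsub)
  have h2 : ∫ κ in Ioo s (2*s), kdens a L x τ κ ≤ ∫ κ in Ioo (0:ℝ) 1, kdens a L x τ κ := by
    refine setIntegral_mono_set hi ?_ hsub.eventuallyLE
    filter_upwards [ae_restrict_mem measurableSet_Ioo] with κ hκ using kdens_nonneg hLpos x hτ hκ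
  refine le_trans (le_of_eq ?_) (h1.trans h2)
  rw [Real.volume_real_Ioo_of_le (by linarith)]
  have e5 : s ^ (a - 1/2) * s = (1/(2*(1+t0))) ^ (a + 1/2) * (x^2) ^ (-(a + 1/2)) := by
    nth_rewrite 2 [← rpow_one s]
    rw [← rpow_add hs0, hs, mul_rpow (by positivity) (by positivity), inv_rpow hy0.le,
      ← rpow_neg hy0.le]
    congr 2 <;> ring
  linear_combination (-(rexp (x^2/2) * c0 * rexp (-(1/2)))) * e5

lemma kdens_moments {a : ℝ} {L : ℝ → ℝ} {Mb c0 t0 K : ℝ} (hL : AssumpL L Mb c0 t0)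
    (hK : Kcond a L K) (x : ℝ) {τ : ℝ} (hτ : 0 < τ) :
    (0 ≤ ∫ κ in Ioo (0:ℝ) 1, κ * kdens a L x τ κ) ∧
    (∫ κ in Ioo (0:ℝ) 1, κ * kdens a L x τ κ ≤ ∫ κ in Ioo (0:ℝ) 1, kdens a L x τ κ) ∧
    (∫ κ in Ioo (0:ℝ) 1, (1 - κ) * kdens a L x τ κ =
      (∫ κ in Ioo (0:ℝ) 1, kdens a L x τ κ) - ∫ κ in Ioo (0:ℝ) 1, κ * kdens a L x τ κ) ∧
    (∫ κ in Ioo (0:ℝ) 1, (1 - κ)^2 * kdens a L x τ κ ≤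
      ∫ κ in Ioo (0:ℝ) 1, (1 - κ) * kdens a L x τ κ) := by
  have hi := kdens_integrableOn hL hK x hτ
  have hn : ∀ κ ∈ Ioo (0:ℝ) 1, 0 ≤ kdens a L x τ κ := fun κ hκ => kdens_nonneg hL.2.1 x hτ hκ
  have hiκ : IntegrableOn (fun κ => κ * kdens a L x τ κ) (Ioo 0 1) := by
    refine Integrable.mono' hi
      (measurable_id.aestronglyMeasurable.mul hi.aestronglyMeasurable) ?_
    filter_upwards [ae_restrict_mem measurableSet_Ioo] with κ hκ
    rw [Real.norm_of_nonneg (mul_nonneg hκ.1.le (hn κ hκ))]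
    exact mul_le_of_le_one_left (hn κ hκ) hκ.2.le
  have hi1 : IntegrableOn (fun κ => (1 - κ) * kdens a L x τ κ) (Ioo 0 1) := by
    have h := hi.sub hiκ
    refine h.congr (ae_of_all _ fun κ => ?_)
    simp only [Pi.sub_apply]; ring
  refine ⟨setIntegral_nonneg measurableSet_Ioo fun κ hκ => mul_nonneg hκ.1.le (hn κ hκ),
    setIntegral_mono_on hiκ hi measurableSet_Ioo fun κ hκ =>
      mul_le_of_le_one_left (hn κ hκ) hκ.2.le, ?_, ?_⟩
  · rw [← integral_sub hi hiκ]
    congr 1; ext κ; ring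
  · refine integral_mono_of_nonneg ?_ hi1 ?_
    · filter_upwards [ae_restrict_mem measurableSet_Ioo] with κ hκ
      exact mul_nonneg (sq_nonneg _) (hn κ hκ)
    · filter_upwards [ae_restrict_mem measurableSet_Ioo] with κ hκ
      refine mul_le_mul_of_nonneg_right ?_ (hn κ hκ)
      nlinarith [hκ.1, hκ.2]

/-- The posterior variance is at most `1 + x² E(κ | x, τ)`. -/
lemma postVar_le {a : ℝ} {L : ℝ → ℝ} {Mb c0 t0 K : ℝ} (hL : AssumpL L Mb c0 t0)
    (hK : Kcond a L K) (x : ℝ) {τ : ℝ} (hτ : 0 < τ) :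
    postVar a L x τ ≤ 1 + x^2 * kExp a L x τ (fun κ => κ) ∧
      kExp a L x τ (fun κ => κ) ≤ 1 := by
  obtain ⟨h0, h1, h2, h3⟩ := kdens_moments hL hK x hτ
  unfold postVar E1mK kExp
  set D := ∫ κ in Ioo (0:ℝ) 1, kdens a L x τ κ
  set N := ∫ κ in Ioo (0:ℝ) 1, κ * kdens a L x τ κ
  rw [h2] at h3 ⊢
  rcases (h0.trans h1).eq_or_lt with hD | hD
  · simp [← hD]
  have hp1 : N / D ≤ 1 := (div_le_one hD).2 h1
  have hp0 : 0 ≤ N / D := by positivity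
  have hq : (D - N) / D = 1 - N / D := by field_simp
  have h4 : (∫ κ in Ioo (0:ℝ) 1, (1 - κ)^2 * kdens a L x τ κ) / D ≤ 1 - N / D := by
    rw [← hq]; gcongr
  refine ⟨?_, hp1⟩
  rw [hq]
  have h5 : (∫ κ in Ioo (0:ℝ) 1, (1 - κ)^2 * kdens a L x τ κ) / D - (1 - N / D)^2 ≤ N / D := by
    nlinarith
  have h6 := mul_le_mul_of_nonneg_left h5 (sq_nonneg x)
  linarith

lemma rpow_mul_exp_neg_le {s y : ℝ} (hs : 0 < s) (hy : 0 < y) :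
    rexp (-(y/8)) ≤ (8 * s) ^ s * y ^ (-s) := by
  have h1 : y / (8 * s) ≤ rexp (y / (8 * s)) := by linarith [Real.add_one_le_exp (y / (8 * s))]
  have h2 : (y / (8 * s)) ^ s ≤ rexp (y / 8) := by
    calc (y / (8 * s)) ^ s ≤ (rexp (y / (8 * s))) ^ s := rpow_le_rpow (by positivity) h1 hs.le
      _ = rexp (y / 8) := by rw [← Real.exp_mul]; congr 1; field_simp
  rw [div_rpow hy.le (by positivity), div_le_iff₀ (by positivity)] at h2
  rw [Real.exp_neg, rpow_neg hy.le, ← div_eq_mul_inv, inv_eq_one_div,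
    div_le_div_iff₀ (Real.exp_pos _) (by positivity)]
  linarith

/-- Beyond `x² = 16 a log n`, the posterior mean of `κ` is of order `x⁻²`, uniformly in
`τ ∈ [1/n, 1]`. -/
lemma exists_sq_mul_kExp_le {a : ℝ} {L : ℝ → ℝ} {Mb c0 t0 K : ℝ} (ha : 1/2 ≤ a)
    (hL : AssumpL L Mb c0 t0) (hK : Kcond a L K) :
    ∃ C : ℝ, 0 < C ∧ ∀ r x τ : ℝ, 0 < r → τ ∈ Icc r⁻¹ 1 → 1 ≤ x^2 →
      16 * a * Real.log r ≤ x^2 → x^2 * kExp a L x τ (fun κ => κ) ≤ C := by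
  have hMb : 0 < Mb := (hL.2.1 1 one_pos).trans_le (hL.2.2.1 1 one_pos)
  obtain ⟨-, -, -, hc0, ht0, -⟩ := id hL
  have hΓ := Real.Gamma_pos_of_pos (s := a + 3/2) (by linarith)
  have hI := hK.2.1
  set I := ∫ t in Ioi (0:ℝ), t ^ (-a-1) * L t
  set cN : ℝ := (2 ^ (a+1) * Mb) * (2 ^ (a + 3/2) * Real.Gamma (a + 3/2)) +
    (8 * (a + 3/2)) ^ (a + 3/2) * I with hcN
  set cD : ℝ := c0 * rexp (-(1/2)) * (1/(2*(1+t0))) ^ (a + 1/2) with hcD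
  have hcD0 : 0 < cD := by positivity
  have hb : 0 < 8 * (a + 3/2) := by linarith
  refine ⟨cN / cD, by positivity, fun r x τ hr hτ hx hxr => ?_⟩
  have hτ0 : 0 < τ := (inv_pos.2 hr).trans_le hτ.1
  have hy : 0 < x^2 := by linarith
  have hup := integral_mul_kdens_le ha hL hK hτ0 hy
  have hlo := integral_kdens_ge ha hL hK hτ0 hτ.2 hx
  rw [← hcD] at hlo
  have hτa : τ ^ (-2 * a) ≤ rexp (x^2/8) := by
    rw [rpow_def_of_pos hτ0]
    apply exp_le_exp.2
    have := Real.log_le_log (inv_pos.2 hr) hτ.1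
    rw [Real.log_inv] at this
    nlinarith
  have hexp : τ ^ (-2 * a) * rexp (-(x^2/4)) ≤
      (8 * (a + 3/2)) ^ (a + 3/2) * (x^2) ^ (-(a + 3/2)) := by
    calc τ ^ (-2 * a) * rexp (-(x^2/4)) ≤ rexp (x^2/8) * rexp (-(x^2/4)) := by gcongr
      _ = rexp (-(x^2/8)) := by rw [← Real.exp_add]; congr 1; ring
      _ ≤ _ := rpow_mul_exp_neg_le (by linarith) hy
  have hpow : (1/(x^2/2)) ^ (a + 3/2) = 2 ^ (a + 3/2) * (x^2) ^ (-(a + 3/2)) := by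
    rw [one_div_div, div_rpow (by norm_num) hy.le, rpow_neg hy.le, div_eq_mul_inv]
  have hN : ∫ κ in Ioo (0:ℝ) 1, κ * kdens a L x τ κ ≤
      rexp (x^2/2) * (cN * (x^2) ^ (-(a + 3/2))) := by
    refine hup.trans ?_
    gcongr
    rw [hpow, hcN, add_mul]
    refine add_le_add (le_of_eq (by ring)) ?_
    calc _ ≤ (8 * (a + 3/2)) ^ (a + 3/2) * (x^2) ^ (-(a + 3/2)) * I := by gcongr
      _ = _ := by ring
  have hshift : x^2 * (x^2) ^ (-(a + 3/2)) = (x^2) ^ (-(a + 1/2)) := by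
    nth_rewrite 1 [← rpow_one (x^2)]
    rw [← rpow_add hy]; congr 1; ring
  have hDpos : 0 < rexp (x^2/2) * (cD * (x^2) ^ (-(a + 1/2))) := by positivity
  unfold kExp
  rw [← mul_div_assoc, div_le_iff₀ (hDpos.trans_le hlo)]
  calc x^2 * ∫ κ in Ioo (0:ℝ) 1, κ * kdens a L x τ κ
      ≤ x^2 * (rexp (x^2/2) * (cN * (x^2) ^ (-(a + 3/2)))) := by gcongr
    _ = cN * rexp (x^2/2) * (x^2) ^ (-(a + 1/2)) := by rw [← hshift]; ring
    _ = cN / cD * (rexp (x^2/2) * (cD * (x^2) ^ (-(a + 1/2)))) := by field_simp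
    _ ≤ _ := by gcongr

/-- The posterior variance is `O(log n)`, uniformly in `x` and in `τ ∈ [1/n, 1]`. -/
lemma exists_postVar_le_log {a : ℝ} {L : ℝ → ℝ} {Mb c0 t0 K : ℝ} (ha : 1/2 ≤ a)
    (hL : AssumpL L Mb c0 t0) (hK : Kcond a L K) :
    ∃ C : ℝ, 0 < C ∧ ∀ n : ℕ, 2 ≤ n → ∀ x : ℝ, ∀ τ ∈ Icc ((n:ℝ)⁻¹) 1,
      postVar a L x τ ≤ C * Real.log n := by
  obtain ⟨C, hC, h⟩ := exists_sq_mul_kExp_le ha hL hK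
  refine ⟨2 * (1 + C) + 16 * a, by positivity, fun n hn x τ hτ => ?_⟩
  have hn' : (2:ℝ) ≤ n := by exact_mod_cast hn
  have hlog : 1/2 ≤ Real.log n :=
    (by linarith [Real.log_two_gt_d9] : (1:ℝ)/2 ≤ Real.log 2).trans
      (Real.log_le_log (by norm_num) hn')
  have hτ0 : 0 < τ := (inv_pos.2 (by linarith)).trans_le hτ.1
  obtain ⟨h1, h2⟩ := postVar_le hL hK x hτ0
  rcases le_total (x^2) (16 * a * Real.log n) with hx | hx
  · have h3 := mul_le_mul_of_nonneg_left h2 (sq_nonneg x)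
    nlinarith
  · have h4 := h n x τ (by linarith) hτ (by nlinarith) hx
    nlinarith [mul_le_mul ha hlog (by norm_num) (by linarith)]

end PaperGL
open PaperGL MeasureTheory ProbabilityTheory Real Filter Set in
/-- the expected supremum over `τ ∈ [1/n,1]` of the posterior variance is `≲ log n`. -/
theorem stmt4 (a : ℝ) (ha : 1/2 ≤ a) (L : ℝ → ℝ) (Mb c0 t0 K : ℝ)
    (hL : AssumpL L Mb c0 t0) (hK : Kcond a L K) :
    ∃ C : ℝ, 0 < C ∧ ∀ n : ℕ, 2 ≤ n → ∀ θ0 : ℝ,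
      (∫ x, sSup ((fun τ => postVar a L x τ) '' Set.Icc ((n:ℝ)⁻¹) 1)
          ∂(gaussianReal θ0 1)) ≤ C * Real.log n := by
  obtain ⟨C, hC, h⟩ := exists_postVar_le_log ha hL hK
  refine ⟨C, hC, fun n hn θ0 => ?_⟩
  have hlog : 0 ≤ C * Real.log n := mul_nonneg hC.le (Real.log_natCast_nonneg n)
  have hsup : ∀ x, sSup ((fun τ => postVar a L x τ) '' Set.Icc ((n:ℝ)⁻¹) 1) ≤
      C * Real.log n := fun x => Real.sSup_le (by rintro _ ⟨τ, hτ, rfl⟩; exact h n hn x τ hτ) hlog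
  by_cases hi : Integrable
      (fun x => sSup ((fun τ => postVar a L x τ) '' Set.Icc ((n:ℝ)⁻¹) 1)) (gaussianReal θ0 1)
  · refine (integral_mono hi (integrable_const _) hsup).trans ?_
    simp
  · rw [integral_undef hi]
    exact hlog
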